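/- arXiv:0804.2469 — 2 statements merged into one kernel-verified Lean document; each statement's English description precedes it below -/
import Mathlib

section
/- Let n ≥ 2 and let x, y ∈ Δ^{n−1} with ‖x − y‖₁ ≤ 1/e. Then |h_n(x) − h_n(y)| ≤ ‖x − y‖₁ · (1 + (1/log n)·log(1/‖x − y‖₁)), with the convention 0·log(∞) := 0 in case ‖x − y‖₁ = 0. -/
/-- The normalized entropy function `h_n(x) = (1/log n) · Σ_i x_i · log(1/x_i)`
(natural logarithm; the convention `0 · log ∞ = 0` holds in Lean since `1/0 = 0`
and `Real.log 0 = 0`). -/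
noncomputable def hEnt (n : ℕ) (x : Fin n → ℝ) : ℝ :=
  (1 / Real.log n) * ∑ i, x i * Real.log (1 / x i)

open Real in
/-- The function `t ↦ -t log t` is subadditive on `[0, ∞)`. -/
lemma negMulLog_add_le {a d : ℝ} (ha : 0 ≤ a) (hd : 0 ≤ d) :
    negMulLog (a + d) ≤ negMulLog a + negMulLog d := by
  rcases ha.eq_or_lt with rfl | ha
  · simp
  rcases hd.eq_or_lt with rfl | hd
  · simp
  have h₁ : a * log a ≤ a * log (a + d) := by gcongr; linarith
  have h₂ : d * log d ≤ d * log (a + d) := by gcongr; linarith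
  simp only [negMulLog]
  linarith

open Real in
lemma negMulLog_sub_negMulLog_add_le {a d : ℝ} (ha : 0 ≤ a) (hd : 0 ≤ d) (had : a + d ≤ 1) :
    negMulLog a - negMulLog (a + d) ≤ d := by
  have hlog : d * log (a + d) ≤ 0 :=
    mul_nonpos_of_nonneg_of_nonpos hd (log_nonpos (by linarith) had)
  rcases ha.eq_or_lt with rfl | ha
  · simp only [negMulLog, zero_add] at *
    linarith
  have hquot : log (a + d) - log a ≤ (a + d) / a - 1 := by
    rw [← log_div (by linarith) ha.ne']
    exact log_le_sub_one_of_pos (by positivity)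
  have hmul : a * (log (a + d) - log a) ≤ d := by
    calc a * (log (a + d) - log a) ≤ a * ((a + d) / a - 1) := by gcongr
      _ = d := by field_simp; ring
  simp only [negMulLog]
  linarith

open Real in
lemma self_le_negMulLog {d : ℝ} (hd : 0 ≤ d) (hde : d ≤ 1 / exp 1) : d ≤ negMulLog d := by
  rcases hd.eq_or_lt with rfl | hd
  · simp
  have hlog : log d ≤ -1 := by
    simpa using log_le_log hd hde
  simp only [negMulLog]
  nlinarith

open Real in
/-- The modulus of continuity of `t ↦ -t log t` on `[0, 1]` at small scales. -/
lemma abs_negMulLog_sub_le {a b : ℝ} (ha : 0 ≤ a) (hb : 0 ≤ b) (ha1 : a ≤ 1) (hb1 : b ≤ 1)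
    (hab : |a - b| ≤ 1 / exp 1) :
    |negMulLog a - negMulLog b| ≤ negMulLog |a - b| := by
  wlog h : b ≤ a generalizing a b
  · rw [abs_sub_comm, abs_sub_comm a b]
    exact this hb ha hb1 ha1 (by rwa [abs_sub_comm]) (le_of_not_ge h)
  rw [abs_of_nonneg (sub_nonneg.2 h)] at hab ⊢
  have hd : 0 ≤ a - b := sub_nonneg.2 h
  have h₁ := negMulLog_add_le hb hd
  have h₂ := negMulLog_sub_negMulLog_add_le hb hd (by linarith)
  have h₃ := self_le_negMulLog hd hab
  rw [add_sub_cancel] at h₁ h₂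
  rw [abs_le]
  constructor <;> linarith

open Real in
/-- Among nonnegative vectors with a given sum, the constant vector maximizes the entropy. -/
lemma sum_negMulLog_le {ι : Type*} [Fintype ι] [Nonempty ι] {d : ι → ℝ} (hd : ∀ i, 0 ≤ d i) :
    ∑ i, negMulLog (d i) ≤ (∑ i, d i) * (log (Fintype.card ι) - log (∑ i, d i)) := by
  set D := ∑ i, d i with hD
  have hcard : (0 : ℝ) < Fintype.card ι := by exact_mod_cast Fintype.card_pos
  have hD0 : 0 ≤ D := Finset.sum_nonneg fun i _ => hd i
  have key : ∀ i, negMulLog (d i) ≤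
      d i * (log (Fintype.card ι) - log D) + (D / Fintype.card ι - d i) := by
    intro i
    rcases (hd i).eq_or_lt with hi | hi
    · simp only [← hi, negMulLog_zero, zero_mul, zero_add, sub_zero]
      positivity
    have hDpos : 0 < D := hi.trans_le (Finset.single_le_sum (fun j _ => hd j) (Finset.mem_univ i))
    have hquot := log_le_sub_one_of_pos (show 0 < D / Fintype.card ι / d i by positivity)
    rw [log_div (by positivity) hi.ne', log_div hDpos.ne' hcard.ne'] at hquot
    have hmul := mul_le_mul_of_nonneg_left hquot hi.le
    rw [mul_sub_one, mul_div_cancel₀ _ hi.ne'] at hmul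
    simp only [negMulLog]
    linarith
  calc ∑ i, negMulLog (d i)
      ≤ ∑ i, (d i * (log (Fintype.card ι) - log D) + (D / Fintype.card ι - d i)) :=
        Finset.sum_le_sum fun i _ => key i
    _ = D * (log (Fintype.card ι) - log D) := by
        rw [Finset.sum_add_distrib, Finset.sum_sub_distrib, ← Finset.sum_mul, ← hD]
        simp only [Finset.sum_const, Finset.card_univ, nsmul_eq_mul]
        rw [mul_div_cancel₀ _ hcard.ne']
        ring

lemma hEnt_eq_sum_negMulLog_div (n : ℕ) (x : Fin n → ℝ) :
    hEnt n x = (∑ i, Real.negMulLog (x i)) / Real.log n := by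
  simp [hEnt, Real.negMulLog, div_eq_inv_mul]

/-- For `n ≥ 2` and `x, y ∈ Δ^{n−1}` with `‖x − y‖₁ ≤ 1/e`:
`|h_n(x) − h_n(y)| ≤ ‖x−y‖₁ · (1 + (1/log n) · log(1/‖x−y‖₁))`. -/
theorem abs_hEnt_sub_le (n : ℕ) (hn : 2 ≤ n) (x y : Fin n → ℝ)
    (hx : x ∈ stdSimplex ℝ (Fin n)) (hy : y ∈ stdSimplex ℝ (Fin n))
    (hxy : ∑ i, |x i - y i| ≤ 1 / Real.exp 1) :
    |hEnt n x - hEnt n y| ≤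
      (∑ i, |x i - y i|) *
        (1 + (1 / Real.log n) * Real.log (1 / ∑ i, |x i - y i|)) := by
  have : NeZero n := ⟨by lia⟩
  have hlog : 0 < Real.log n := Real.log_pos (by exact_mod_cast hn)
  have hle_one : ∀ {z : Fin n → ℝ}, z ∈ stdSimplex ℝ (Fin n) → ∀ i, z i ≤ 1 := fun hz i =>
    hz.2 ▸ Finset.single_le_sum (fun j _ => hz.1 j) (Finset.mem_univ i)
  have hdist : ∀ i, |x i - y i| ≤ 1 / Real.exp 1 := fun i =>
    (Finset.single_le_sum (f := fun j => |x j - y j|) (fun j _ => abs_nonneg _)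
      (Finset.mem_univ i)).trans hxy
  rw [hEnt_eq_sum_negMulLog_div, hEnt_eq_sum_negMulLog_div, ← sub_div, abs_div,
    abs_of_pos hlog, div_le_iff₀ hlog, ← Finset.sum_sub_distrib]
  calc |∑ i, (Real.negMulLog (x i) - Real.negMulLog (y i))|
      ≤ ∑ i, |Real.negMulLog (x i) - Real.negMulLog (y i)| := Finset.abs_sum_le_sum_abs _ _
    _ ≤ ∑ i, Real.negMulLog |x i - y i| := Finset.sum_le_sum fun i _ =>
        abs_negMulLog_sub_le (hx.1 i) (hy.1 i) (hle_one hx i) (hle_one hy i) (hdist i)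
    _ ≤ (∑ i, |x i - y i|) * (Real.log n - Real.log (∑ i, |x i - y i|)) := by
        simpa using sum_negMulLog_le fun i => abs_nonneg (x i - y i)
    _ = _ := by
        rw [one_div (∑ i, _), Real.log_inv]
        field_simp
        ring
end

section
/- The upper and lower entropy rates are Lipschitz continuous with Lipschitz constant log|Σ| with respect to d_TV: for all probability measures P, Q on Ω = Σ^ℕ, |H̄(P) − H̄(Q)| ≤ (log|Σ|)·d_TV(P,Q) and |H̲(P) − H̲(Q)| ≤ (log|Σ|)·d_TV(P,Q). -/
open MeasureTheory Filter
open scoped ENNReal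

variable {α : Type*}

/-- The cylinder set of sequences in `Ω = Σ^ℕ` whose first `t` symbols are `v`. -/
def cylinder (t : ℕ) (v : Fin t → α) : Set (ℕ → α) :=
  {ω | ∀ i : Fin t, ω (i : ℕ) = v i}

variable [Fintype α] [Nonempty α] [MeasurableSpace α] [DiscreteMeasurableSpace α]

/-- `P(v)`, the probability that the source emits the word `v`. -/
noncomputable def wordProb (P : Measure (ℕ → α)) {t : ℕ} (v : Fin t → α) : ℝ :=
  (P (cylinder t v)).toReal

/-- `H^t(P)`, the entropy of the induced distribution on words of length `t`, divided
by `t` (natural logarithm; the convention `0 · log 0 = 0` holds since `Real.log 0 = 0`). -/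
noncomputable def Hn (P : Measure (ℕ → α)) (t : ℕ) : ℝ :=
  -(1 / (t : ℝ)) * ∑ v : Fin t → α, wordProb P v * Real.log (wordProb P v)

/-- `d_{TV,t}(P,Q) = Σ_{v ∈ Σ^t} |P(v) − Q(v)|`. -/
noncomputable def dTVt (P Q : Measure (ℕ → α)) (t : ℕ) : ℝ :=
  ∑ v : Fin t → α, |wordProb P v - wordProb Q v|

/-- `d_TV(P,Q) = sup_{t ∈ ℕ} d_{TV,t}(P,Q)`. -/
noncomputable def dTV (P Q : Measure (ℕ → α)) : ℝ := ⨆ t : ℕ, dTVt P Q t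

/-- A tangent-line bound on `x ↦ -x log x`. -/
lemma negMulLog_le_mul_log_add {N x : ℝ} (hN : 0 < N) (hx : 0 ≤ x) :
    Real.negMulLog x ≤ x * Real.log N + 1 / N - x := by
  rcases hx.eq_or_lt with rfl | hx
  · simp [hN.le]
  · have h := Real.log_le_sub_one_of_pos (x := 1 / (N * x)) (by positivity)
    rw [one_div, Real.log_inv, Real.log_mul hN.ne' hx.ne'] at h
    have h' := mul_le_mul_of_nonneg_left h hx.le
    have e : x * ((N * x)⁻¹ - 1) = 1 / N - x := by field_simp
    rw [e] at h'
    rw [Real.negMulLog]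
    linarith

lemma abs_negMulLog_sub_le_of_le {x y : ℝ} (hx : 0 ≤ x) (hxy : x ≤ y) (hy : y ≤ 1) :
    |Real.negMulLog y - Real.negMulLog x| ≤ Real.negMulLog (y - x) + (y - x) := by
  rcases hx.eq_or_lt with rfl | hx
  · rw [Real.negMulLog_zero, sub_zero, sub_zero, abs_of_nonneg (Real.negMulLog_nonneg hxy hy)]
    linarith
  rcases hxy.eq_or_lt with rfl | hlt
  · simp
  have hy0 : 0 < y := hx.trans hlt
  have hd : 0 < y - x := sub_pos.2 hlt
  have hn : 0 ≤ Real.negMulLog (y - x) := Real.negMulLog_nonneg hd.le (by linarith)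
  have h₁ : x * Real.log x ≤ x * Real.log y :=
    mul_le_mul_of_nonneg_left (Real.log_le_log hx hxy) hx.le
  have h₂ : (y - x) * Real.log (y - x) ≤ (y - x) * Real.log y :=
    mul_le_mul_of_nonneg_left (Real.log_le_log hd (by linarith)) hd.le
  have h₃ : (y - x) * Real.log y ≤ 0 :=
    mul_nonpos_of_nonneg_of_nonpos hd.le (Real.log_nonpos hy0.le hy)
  have h₄ : x * (Real.log y - Real.log x) ≤ y - x := by
    have h := Real.log_le_sub_one_of_pos (x := y / x) (by positivity)
    rw [Real.log_div hy0.ne' hx.ne'] at h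
    have e : x * (y / x - 1) = y - x := by field_simp
    exact (mul_le_mul_of_nonneg_left h hx.le).trans_eq e
  unfold Real.negMulLog at *
  rw [abs_le]
  constructor <;> linarith

lemma abs_negMulLog_sub_le_s6 {x y : ℝ} (hx : 0 ≤ x) (hx1 : x ≤ 1) (hy : 0 ≤ y) (hy1 : y ≤ 1) :
    |Real.negMulLog x - Real.negMulLog y| ≤ Real.negMulLog |x - y| + |x - y| := by
  rcases le_total x y with h | h
  · rw [abs_sub_comm x y, abs_of_nonneg (sub_nonneg.2 h), abs_sub_comm]
    exact abs_negMulLog_sub_le_of_le hx h hy1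
  · rw [abs_of_nonneg (sub_nonneg.2 h)]
    exact abs_negMulLog_sub_le_of_le hy h hx1

lemma sum_negMulLog_le_log_card {ι : Type*} [Fintype ι] [Nonempty ι] {p : ι → ℝ}
    (hp : ∀ i, 0 ≤ p i) (hsum : ∑ i, p i = 1) :
    ∑ i, Real.negMulLog (p i) ≤ Real.log (Fintype.card ι) := by
  have hN : (0 : ℝ) < Fintype.card ι := by exact_mod_cast Fintype.card_pos
  calc ∑ i, Real.negMulLog (p i)
      ≤ ∑ i, (p i * Real.log (Fintype.card ι) + 1 / Fintype.card ι - p i) :=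
        Finset.sum_le_sum fun i _ => negMulLog_le_mul_log_add hN (hp i)
    _ = Real.log (Fintype.card ι) := by
        rw [Finset.sum_sub_distrib, Finset.sum_add_distrib, ← Finset.sum_mul, hsum]
        simp [hN.ne']

/-- Entropy on a finite set is continuous in the `ℓ¹` distance, up to an additive constant. -/
lemma abs_sum_negMulLog_sub_le {ι : Type*} [Fintype ι] [Nonempty ι] {p q : ι → ℝ}
    (hp : ∀ i, 0 ≤ p i) (hp1 : ∀ i, p i ≤ 1) (hq : ∀ i, 0 ≤ q i) (hq1 : ∀ i, q i ≤ 1) :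
    |∑ i, Real.negMulLog (p i) - ∑ i, Real.negMulLog (q i)| ≤
      Real.log (Fintype.card ι) * ∑ i, |p i - q i| + 1 := by
  have hN : (0 : ℝ) < Fintype.card ι := by exact_mod_cast Fintype.card_pos
  rw [← Finset.sum_sub_distrib]
  calc |∑ i, (Real.negMulLog (p i) - Real.negMulLog (q i))|
      ≤ ∑ i, |Real.negMulLog (p i) - Real.negMulLog (q i)| := Finset.abs_sum_le_sum_abs _ _
    _ ≤ ∑ i, (Real.log (Fintype.card ι) * |p i - q i| + 1 / Fintype.card ι) := by
        refine Finset.sum_le_sum fun i _ => ?_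
        have h₁ := abs_negMulLog_sub_le_s6 (hp i) (hp1 i) (hq i) (hq1 i)
        have h₂ := negMulLog_le_mul_log_add hN (abs_nonneg (p i - q i))
        linarith
    _ = Real.log (Fintype.card ι) * ∑ i, |p i - q i| + 1 := by
        rw [Finset.sum_add_distrib, ← Finset.mul_sum]
        simp [hN.ne']

lemma limsup_le_limsup_add {f g : ℕ → ℝ} {c : ℝ}
    (hf : IsCoboundedUnder (· ≤ ·) atTop f) (hg : IsBoundedUnder (· ≤ ·) atTop g)
    (h : ∀ ε > 0, ∀ᶠ t in atTop, f t ≤ g t + (c + ε)) :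
    limsup f atTop ≤ limsup g atTop + c := by
  refine le_of_forall_pos_le_add fun ε hε => ?_
  refine limsup_le_of_le hf ?_
  filter_upwards [h (ε / 2) (half_pos hε),
    eventually_lt_of_limsup_lt (lt_add_of_pos_right _ (half_pos hε)) hg] with t h₁ h₂
  linarith

lemma liminf_le_liminf_add {f g : ℕ → ℝ} {c : ℝ}
    (hf : IsBoundedUnder (· ≥ ·) atTop f) (hg : IsCoboundedUnder (· ≥ ·) atTop g)
    (h : ∀ ε > 0, ∀ᶠ t in atTop, f t ≤ g t + (c + ε)) :
    liminf f atTop ≤ liminf g atTop + c := by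
  refine le_of_forall_pos_le_add fun ε hε => ?_
  suffices liminf f atTop - c - ε ≤ liminf g atTop by linarith
  refine le_liminf_of_le hg ?_
  filter_upwards [h (ε / 2) (half_pos hε),
    eventually_lt_of_lt_liminf (sub_lt_self _ (half_pos hε)) hf] with t h₁ h₂
  linarith

lemma wordProb_nonneg {β : Type*} [MeasurableSpace β]
    (P : Measure (ℕ → β)) {t : ℕ} (v : Fin t → β) : 0 ≤ wordProb P v :=
  ENNReal.toReal_nonneg

lemma wordProb_le_one {β : Type*} [MeasurableSpace β]
    (P : Measure (ℕ → β)) [IsProbabilityMeasure P] {t : ℕ} (v : Fin t → β) :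
    wordProb P v ≤ 1 :=
  measureReal_le_one

lemma sum_wordProb {β : Type*} [Fintype β] [MeasurableSpace β] [DiscreteMeasurableSpace β]
    (P : Measure (ℕ → β)) [IsProbabilityMeasure P] (t : ℕ) :
    ∑ v : Fin t → β, wordProb P v = 1 := by
  have hm : Measurable fun (ω : ℕ → β) (i : Fin t) => ω i := by fun_prop
  have h := sum_measureReal_preimage_singleton (μ := P) (f := fun ω (i : Fin t) => ω i)
    Finset.univ (fun v _ => hm (measurableSet_singleton v))
  rw [Finset.coe_univ, Set.preimage_univ, probReal_univ] at h
  rw [← h]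
  refine Finset.sum_congr rfl fun v _ => ?_
  have e : cylinder t v = (fun (ω : ℕ → β) (i : Fin t) => ω i) ⁻¹' {v} := by
    ext ω
    simp [_root_.cylinder, funext_iff]
  rw [wordProb, e, measureReal_def]

lemma Hn_eq_sum_negMulLog_div {β : Type*} [Fintype β] [MeasurableSpace β]
    (P : Measure (ℕ → β)) (t : ℕ) :
    Hn P t = (∑ v : Fin t → β, Real.negMulLog (wordProb P v)) / t := by
  simp only [Hn, Real.negMulLog, neg_mul, Finset.sum_neg_distrib]
  ring

lemma log_card_words {β : Type*} [Fintype β] (t : ℕ) :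
    Real.log (Fintype.card (Fin t → β)) = t * Real.log (Fintype.card β) := by
  simp

lemma Hn_nonneg {β : Type*} [Fintype β] [MeasurableSpace β]
    (P : Measure (ℕ → β)) [IsProbabilityMeasure P] (t : ℕ) : 0 ≤ Hn P t := by
  rw [Hn_eq_sum_negMulLog_div]
  exact div_nonneg (Finset.sum_nonneg fun v _ =>
    Real.negMulLog_nonneg (wordProb_nonneg P v) (wordProb_le_one P v)) t.cast_nonneg

lemma Hn_le_log_card (P : Measure (ℕ → α)) [IsProbabilityMeasure P] (t : ℕ) :
    Hn P t ≤ Real.log (Fintype.card α) := by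
  rw [Hn_eq_sum_negMulLog_div]
  refine div_le_of_le_mul₀ t.cast_nonneg (Real.log_natCast_nonneg _) ?_
  rw [mul_comm, ← log_card_words]
  exact sum_negMulLog_le_log_card (wordProb_nonneg P) (sum_wordProb P t)

lemma dTVt_le_dTV {β : Type*} [Fintype β] [MeasurableSpace β] [DiscreteMeasurableSpace β]
    (P Q : Measure (ℕ → β)) [IsProbabilityMeasure P] [IsProbabilityMeasure Q] (t : ℕ) :
    dTVt P Q t ≤ dTV P Q := by
  refine le_ciSup (f := dTVt P Q) ⟨2, ?_⟩ t
  rintro _ ⟨s, rfl⟩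
  calc dTVt P Q s ≤ ∑ v : Fin s → β, (wordProb P v + wordProb Q v) :=
        Finset.sum_le_sum fun v _ => (abs_sub _ _).trans_eq (by
          rw [abs_of_nonneg (wordProb_nonneg P v), abs_of_nonneg (wordProb_nonneg Q v)])
    _ = 2 := by rw [Finset.sum_add_distrib, sum_wordProb, sum_wordProb]; norm_num

lemma dTV_comm {β : Type*} [Fintype β] [MeasurableSpace β]
    (P Q : Measure (ℕ → β)) : dTV P Q = dTV Q P := by
  simp only [dTV, dTVt, abs_sub_comm]

lemma Hn_le_Hn_add (P Q : Measure (ℕ → α)) [IsProbabilityMeasure P] [IsProbabilityMeasure Q]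
    {t : ℕ} (ht : 0 < t) :
    Hn P t ≤ Hn Q t + (Real.log (Fintype.card α) * dTV P Q + 1 / t) := by
  have h := (le_abs_self _).trans (abs_sum_negMulLog_sub_le (p := wordProb P (t := t))
    (q := wordProb Q) (wordProb_nonneg P) (wordProb_le_one P) (wordProb_nonneg Q)
    (wordProb_le_one Q))
  have hd : Real.log (Fintype.card (Fin t → α)) * dTVt P Q t ≤
      Real.log (Fintype.card (Fin t → α)) * dTV P Q :=
    mul_le_mul_of_nonneg_left (dTVt_le_dTV P Q t) (Real.log_natCast_nonneg _)
  rw [dTVt] at hd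
  replace h := h.trans (add_le_add_left hd 1)
  rw [log_card_words] at h
  have ht' : (0 : ℝ) < t := by exact_mod_cast ht
  rw [Hn_eq_sum_negMulLog_div, Hn_eq_sum_negMulLog_div, div_le_iff₀ ht']
  field_simp
  linarith

lemma entropyRate_le_add (P Q : Measure (ℕ → α))
    [IsProbabilityMeasure P] [IsProbabilityMeasure Q] :
    limsup (Hn P) atTop ≤ limsup (Hn Q) atTop + Real.log (Fintype.card α) * dTV P Q ∧
    liminf (Hn P) atTop ≤ liminf (Hn Q) atTop + Real.log (Fintype.card α) * dTV P Q := by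
  have above (R : Measure (ℕ → α)) [IsProbabilityMeasure R] :
      IsBoundedUnder (· ≤ ·) atTop (Hn R) := isBoundedUnder_of ⟨_, Hn_le_log_card R⟩
  have below (R : Measure (ℕ → α)) [IsProbabilityMeasure R] :
      IsBoundedUnder (· ≥ ·) atTop (Hn R) := isBoundedUnder_of ⟨_, Hn_nonneg R⟩
  have h : ∀ ε > 0, ∀ᶠ t in atTop,
      Hn P t ≤ Hn Q t + (Real.log (Fintype.card α) * dTV P Q + ε) := fun ε hε => by
    filter_upwards [eventually_gt_atTop 0,
      tendsto_one_div_atTop_nhds_zero_nat.eventually_lt_const hε] with t ht hlt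
    linarith [Hn_le_Hn_add P Q ht]
  exact ⟨limsup_le_limsup_add (below P).isCoboundedUnder_le (above Q) h,
    liminf_le_liminf_add (below P) (above Q).isCoboundedUnder_ge h⟩

/-- Theorem 1 (Lipschitz continuity of entropy rate): the upper and lower entropy
rates `H̄(P) = limsup_t H^t(P)` and `H̲(P) = liminf_t H^t(P)` are Lipschitzian with
constant `log|Σ|` relative to the metric of total variation `d_TV`. -/
theorem entropyRate_lipschitz (P Q : Measure (ℕ → α))
    [IsProbabilityMeasure P] [IsProbabilityMeasure Q] :
    |limsup (Hn P) atTop - limsup (Hn Q) atTop| ≤ Real.log (Fintype.card α) * dTV P Q ∧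
    |liminf (Hn P) atTop - liminf (Hn Q) atTop| ≤ Real.log (Fintype.card α) * dTV P Q := by
  obtain ⟨h₁, h₂⟩ := entropyRate_le_add P Q
  obtain ⟨h₃, h₄⟩ := entropyRate_le_add Q P
  rw [dTV_comm Q P] at h₃ h₄
  constructor <;> rw [abs_le] <;> constructor <;> linarith
end
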